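/- Let s : ℕ → (0,∞) with ∑_{k∈ℕ} 2^{−2 s_k} < ∞, and let γ assign to each finite subset of ℕ a positive real number such that for some constant C < ∞ and every finite ω₀ ⊆ ℕ one has ∑_{ω ⊇ ω₀} γ(ω) ≤ C γ(ω₀) (unordered sum over all finite supersets ω of ω₀). For a multi-index j define a_j := γ(supp(j))⁻¹ · ∏_{k ∈ supp(j)} 2^{2 s_k j_k}. Then for every multi-index i, a_i · ∑_{j ≥ i} a_j⁻¹ ≤ C · ∏_{k∈ℕ} (1 − 2^{−2 s_k})⁻¹, and this bound is finite. -/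

import Mathlib

open scoped ENNReal

/-- The Sobolev-type tensor product weights of Section 4:
`a_j = γ(supp j)⁻¹ ∏_{k ∈ supp j} 2^{2 s_k j_k}`. -/
noncomputable def sobolevWeight (s : ℕ → ℝ) (γ : Finset ℕ → ℝ) (j : ℕ →₀ ℕ) : ℝ :=
  (γ j.support)⁻¹ * ∏ k ∈ j.support, (2 : ℝ) ^ (2 * s k * (j k : ℝ))

lemma aux_mult (x : ℕ → ℝ) (h0 : ∀ k, 0 < x k) (h1 : ∀ k, x k < 1) (hx : Summable x) :
    Multipliable (fun k => (1 - x k)⁻¹) := by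
  have hs : Summable (fun k => ‖x k / (1 - x k)‖) := by
    refine Summable.of_norm_bounded_eventually (g := fun k => 2 * x k) (hx.mul_left 2) ?_
    have := hx.tendsto_cofinite_zero.eventually (gt_mem_nhds (show (0 : ℝ) < 1 / 2 by norm_num))
    filter_upwards [this] with k hk
    have h2 : 0 < 1 - x k := by linarith
    rw [norm_norm, Real.norm_of_nonneg (div_nonneg (h0 k).le h2.le), div_le_iff₀ h2]
    nlinarith [h0 k]
  refine (multipliable_one_add_of_summable hs).congr fun k => ?_
  have h2 : 1 - x k ≠ 0 := by linarith [h1 k]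
  field_simp
  ring

lemma aux_one_le (x : ℕ → ℝ) (h0 : ∀ k, 0 < x k) (h1 : ∀ k, x k < 1) (k : ℕ) :
    1 ≤ (1 - x k)⁻¹ :=
  (one_le_inv₀ (by linarith [h1 k])).2 (by linarith [h0 k])

lemma aux_prod_le (x : ℕ → ℝ) (h0 : ∀ k, 0 < x k) (h1 : ∀ k, x k < 1) (hx : Summable x)
    (ω : Finset ℕ) : ∏ k ∈ ω, (1 - x k)⁻¹ ≤ ∏' k, (1 - x k)⁻¹ := by
  refine ge_of_tendsto (aux_mult x h0 h1 hx).hasProd ?_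
  filter_upwards [Filter.eventually_ge_atTop ω] with t ht
  rw [← Finset.prod_sdiff ht]
  refine le_mul_of_one_le_left ?_ ?_
  · exact Finset.prod_nonneg fun k _ => zero_le_one.trans (aux_one_le x h0 h1 k)
  · exact Finset.one_le_prod fun k _ => aux_one_le x h0 h1 k

lemma aux_geom (x : ℕ → ℝ) (h0 : ∀ k, 0 < x k) (h1 : ∀ k, x k < 1)
    (ω : Finset ℕ) (T : Finset (ℕ →₀ ℕ)) (hT : ∀ m ∈ T, m.support ⊆ ω) :
    ∑ m ∈ T, ∏ k ∈ ω, x k ^ m k ≤ ∏ k ∈ ω, (1 - x k)⁻¹ := by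
  classical
  set t : ℕ → Finset ℕ := fun k => T.image (fun m => m k)
  have hsub : T ⊆ ω.finsupp t := by
    intro m hm
    rw [Finset.mem_finsupp_iff]
    exact ⟨hT m hm, fun k _ => Finset.mem_image_of_mem _ hm⟩
  calc ∑ m ∈ T, ∏ k ∈ ω, x k ^ m k ≤ ∑ m ∈ ω.finsupp t, ∏ k ∈ ω, x k ^ m k :=
        Finset.sum_le_sum_of_subset_of_nonneg hsub
          fun m _ _ => Finset.prod_nonneg fun k _ => pow_nonneg (h0 k).le _
    _ = ∏ k ∈ ω, ∑ n ∈ t k, x k ^ n := by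
        rw [Finset.prod_sum, Finset.finsupp, Finset.sum_map]
        refine Finset.sum_congr (by congr!) fun p _ => ?_
        rw [← Finset.prod_attach]
        refine Finset.prod_congr rfl fun k _ => ?_
        simp
    _ ≤ ∏ k ∈ ω, (1 - x k)⁻¹ := by
        refine Finset.prod_le_prod (fun k _ => Finset.sum_nonneg fun n _ => pow_nonneg (h0 k).le _)
          fun k _ => ?_
        rw [← tsum_geometric_of_lt_one (h0 k).le (h1 k)]
        exact (summable_geometric_of_lt_one (h0 k).le (h1 k)).sum_le_tsum _
          fun n _ => pow_nonneg (h0 k).le _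

lemma aux_weight (s : ℕ → ℝ) (γ : Finset ℕ → ℝ) (j : ℕ →₀ ℕ) (ω : Finset ℕ)
    (h : j.support ⊆ ω) : sobolevWeight s γ j =
      (γ j.support)⁻¹ * (∏ k ∈ ω, ((2 : ℝ) ^ (-(2 * s k))) ^ j k)⁻¹ := by
  unfold sobolevWeight
  congr 1
  rw [← Finset.prod_inv_distrib]
  rw [← Finset.prod_subset h (f := fun k => (((2 : ℝ) ^ (-(2 * s k))) ^ j k)⁻¹)]
  · refine Finset.prod_congr rfl fun k _ => ?_
    rw [Real.rpow_mul (by norm_num), Real.rpow_natCast, Real.rpow_neg (by norm_num), inv_pow,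
      inv_inv]
  · intro k _ hk
    simp [Finsupp.notMem_support_iff.1 hk]

/-- Section 4, sufficiency.
Assume `s > 0` with `∑_k 2^{-2 s_k} < ∞` and `γ > 0` with
`∑_{ω ⊇ ω₀} γ(ω) ≤ C γ(ω₀)` for all finite `ω₀ ⊆ ℕ`.  Then for the weights
`a_j = γ(supp j)⁻¹ ∏_{k ∈ supp j} 2^{2 s_k j_k}` one has, for every multi-index `i`,
`a_i ∑_{j ≥ i} a_j⁻¹ ≤ C ∏_k (1 - 2^{-2 s_k})⁻¹`, and this bound is finite (the infinite
product converges). -/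
theorem stmt12 (s : ℕ → ℝ) (hs : ∀ k, 0 < s k)
    (hssum : Summable fun k => (2 : ℝ) ^ (-(2 * s k)))
    (γ : Finset ℕ → ℝ) (hγ : ∀ ω, 0 < γ ω) (C : ℝ)
    (hγsum : ∀ ω₀ : Finset ℕ,
      ∑' ω : {ω : Finset ℕ // ω₀ ⊆ ω}, ENNReal.ofReal (γ (ω : Finset ℕ)) ≤
        ENNReal.ofReal (C * γ ω₀)) :
    Multipliable (fun k => (1 - (2 : ℝ) ^ (-(2 * s k)))⁻¹) ∧
    ∀ i : ℕ →₀ ℕ,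
      ENNReal.ofReal (sobolevWeight s γ i) *
          ∑' j : {j : ℕ →₀ ℕ // i ≤ j},
            ENNReal.ofReal ((sobolevWeight s γ (j : ℕ →₀ ℕ))⁻¹) ≤
        ENNReal.ofReal (C * ∏' k, (1 - (2 : ℝ) ^ (-(2 * s k)))⁻¹) := by
  have h0 : ∀ k, 0 < (2 : ℝ) ^ (-(2 * s k)) := fun k => by positivity
  have h1 : ∀ k, (2 : ℝ) ^ (-(2 * s k)) < 1 := fun k =>
    Real.rpow_lt_one_of_one_lt_of_neg (by norm_num) (by linarith [hs k])
  refine ⟨aux_mult _ h0 h1 hssum, fun i => ?_⟩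
  have hPle := aux_prod_le _ h0 h1 hssum
  have hgeom := aux_geom _ h0 h1
  have hw := aux_weight s γ
  set x : ℕ → ℝ := fun k => (2 : ℝ) ^ (-(2 * s k)) with hxdef
  change ∀ ω : Finset ℕ, ∏ k ∈ ω, (1 - x k)⁻¹ ≤ ∏' k, (1 - x k)⁻¹ at hPle
  change _ ≤ ENNReal.ofReal (C * ∏' k, (1 - x k)⁻¹)
  set P : ℝ := ∏' k, (1 - x k)⁻¹
  have hP : 0 ≤ P := zero_le_one.trans (by simpa using hPle ∅)
  have hgi := hγ i.support
  let g : {j : ℕ →₀ ℕ // i ≤ j} → {ω : Finset ℕ // i.support ⊆ ω} :=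
    fun j => ⟨j.1.support, Finsupp.support_mono j.2⟩
  rw [← ENNReal.tsum_fiberwise _ g, ← ENNReal.tsum_mul_left]
  calc _ ≤ ∑' ω : {ω : Finset ℕ // i.support ⊆ ω},
          ENNReal.ofReal (γ (ω : Finset ℕ)) * ENNReal.ofReal (P / γ i.support) := by
        refine ENNReal.tsum_le_tsum fun ω => ?_
        rw [← ENNReal.tsum_mul_left, ENNReal.tsum_eq_iSup_sum]
        refine iSup_le fun T => ?_
        have key : ∀ b : (g ⁻¹' {ω} : Set _),
            ENNReal.ofReal (sobolevWeight s γ i) *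
              ENNReal.ofReal ((sobolevWeight s γ (b.1.1 : ℕ →₀ ℕ))⁻¹) =
            ENNReal.ofReal (γ ω.1 / γ i.support * ∏ k ∈ ω.1, x k ^ ((b.1.1 - i) k)) := by
          intro b
          have hb : b.1.1.support = ω.1 := congrArg Subtype.val b.2
          have hle : i ≤ b.1.1 := b.1.2
          rw [hw i ω.1 ω.2, hw b.1.1 ω.1 hb.le, hb, ← ENNReal.ofReal_mul]
          · congr 1
            have e : ∏ k ∈ ω.1, x k ^ (b.1.1 k) =
                (∏ k ∈ ω.1, x k ^ ((b.1.1 - i) k)) * ∏ k ∈ ω.1, x k ^ (i k) := by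
              rw [← Finset.prod_mul_distrib]
              refine Finset.prod_congr rfl fun k _ => ?_
              rw [← pow_add, Finsupp.tsub_apply, Nat.sub_add_cancel (hle k)]
            have hne : ∏ k ∈ ω.1, x k ^ (i k) ≠ 0 :=
              Finset.prod_ne_zero_iff.2 fun k _ => pow_ne_zero _ (h0 k).ne'
            change (γ i.support)⁻¹ * (∏ k ∈ ω.1, x k ^ (i k))⁻¹ *
              ((γ ω.1)⁻¹ * (∏ k ∈ ω.1, x k ^ (b.1.1 k))⁻¹)⁻¹ = _
            rw [e]
            simp only [mul_inv, inv_inv]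
            field_simp
          · refine mul_nonneg (inv_nonneg.2 hgi.le) (inv_nonneg.2 ?_)
            exact Finset.prod_nonneg fun k _ => pow_nonneg (h0 k).le _
        have hc : 0 ≤ γ ω.1 / γ i.support := div_nonneg (hγ _).le hgi.le
        rw [Finset.sum_congr rfl fun b _ => key b, ← ENNReal.ofReal_sum_of_nonneg,
          ← ENNReal.ofReal_mul (hγ _).le]
        · refine ENNReal.ofReal_le_ofReal ?_
          rw [← Finset.mul_sum]
          have : ∑ b ∈ T, ∏ k ∈ ω.1, x k ^ ((b.1.1 - i) k) ≤ P := by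
            classical
            refine le_trans ?_ (hPle ω.1)
            have hinj : Set.InjOn (fun b : (g ⁻¹' {ω} : Set _) => b.1.1 - i) T := by
              intro b _ c _ hbc
              apply Subtype.ext
              apply Subtype.ext
              have hb : i ≤ b.1.1 := b.1.2
              have hc : i ≤ c.1.1 := c.1.2
              rw [← tsub_add_cancel_of_le hb, ← tsub_add_cancel_of_le hc]
              exact congrArg (· + i) hbc
            rw [← Finset.sum_image (f := fun m : ℕ →₀ ℕ => ∏ k ∈ ω.1, x k ^ (m k)) hinj]
            refine hgeom ω.1 _ ?_
            intro m hm
            obtain ⟨b, _, rfl⟩ := Finset.mem_image.1 hm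
            have hb : b.1.1.support = ω.1 := congrArg Subtype.val b.2
            rw [← hb]
            exact Finsupp.support_mono tsub_le_self
          calc _ ≤ γ ω.1 / γ i.support * P := mul_le_mul_of_nonneg_left this hc
            _ = _ := by ring
        · intro b _
          exact mul_nonneg hc (Finset.prod_nonneg fun k _ => pow_nonneg (h0 k).le _)
    _ ≤ ENNReal.ofReal (C * γ i.support) * ENNReal.ofReal (P / γ i.support) := by
        rw [ENNReal.tsum_mul_right]
        gcongr
        exact hγsum i.support
    _ = ENNReal.ofReal (C * P) := by
        rw [← ENNReal.ofReal_mul' (div_nonneg hP hgi.le)]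
        congr 1
        field_simp
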